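/- arXiv:1504.06118 — 2 statements merged into one kernel-verified Lean document; each statement's English description precedes it below -/
import Mathlib

section
/- Let f : ℝ → ℝ be twice continuously differentiable, let u_R ∈ ℝ with f'(u_R) < 0, set f_∞ = f(u_R), and let p ≥ 0 be an integer. Define G : ℝ^{p+1} → ℝ^{p+1} by G^0(U) = f(∑_{l=0}^{p} (−1)^l U_l) − f_∞ and, for 1 ≤ k ≤ p, G^k(U) = ∫_{-1}^{1} f(∑_{l=0}^{p} U_l L_l(s)) · L_k'(s) ds − (1 − (−1)^k) f_∞. Then there exists an open neighborhood of the point U_R = (u_R, 0, …, 0) in ℝ^{p+1} in which U_R is the unique zero of G. -/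
/-- The Legendre polynomials on `[-1,1]`, defined by `L 0 = 1`, `L 1 = id` and the
Bonnet recurrence `(k+1) L_{k+1}(s) = (2k+1) s L_k(s) - k L_{k-1}(s)`. -/
noncomputable def legendre : ℕ → ℝ → ℝ
  | 0, _ => 1
  | 1, s => s
  | (k+2), s =>
      ((2 * (k : ℝ) + 3) * s * legendre (k+1) s - ((k : ℝ) + 1) * legendre k s) / ((k : ℝ) + 2)

open Polynomial in
/-- The Legendre polynomials as elements of `ℝ[X]`. -/
noncomputable def legendrePoly : ℕ → ℝ[X]
  | 0 => 1
  | 1 => X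
  | (k+2) => C ((k : ℝ) + 2)⁻¹ *
      (C (2 * (k : ℝ) + 3) * X * legendrePoly (k+1) - C ((k : ℝ) + 1) * legendrePoly k)

theorem eval_legendrePoly (k : ℕ) (s : ℝ) : (legendrePoly k).eval s = legendre k s := by
  induction k using Nat.twoStepInduction with
  | zero => simp [legendrePoly, legendre]
  | one => simp [legendrePoly, legendre]
  | more k h₀ h₁ =>
    simp only [legendrePoly, legendre, Polynomial.eval_mul, Polynomial.eval_sub,
      Polynomial.eval_C, Polynomial.eval_X, h₀, h₁]
    ring

theorem deriv_legendre (k : ℕ) (s : ℝ) :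
    deriv (legendre k) s = (Polynomial.derivative (legendrePoly k)).eval s := by
  rw [← Polynomial.deriv]
  exact congrArg (deriv · s) (funext fun t => (eval_legendrePoly k t).symm)

theorem degree_legendrePoly (k : ℕ) : (legendrePoly k).degree = k := by
  induction k using Nat.twoStepInduction with
  | zero => simp [legendrePoly]
  | one => simp [legendrePoly]
  | more k h₀ h₁ =>
    have hlead : (Polynomial.C (2 * (k : ℝ) + 3) * Polynomial.X * legendrePoly (k+1)).degree =
        ((k + 2 : ℕ) : WithBot ℕ) := by
      rw [Polynomial.degree_mul, Polynomial.degree_mul, h₁,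
        Polynomial.degree_C (by positivity), Polynomial.degree_X, ← Nat.cast_one, zero_add,
        ← Nat.cast_add]
      congr 1
      omega
    have hlow : (Polynomial.C ((k : ℝ) + 1) * legendrePoly k).degree = (k : WithBot ℕ) := by
      rw [Polynomial.degree_mul, h₀, Polynomial.degree_C (by positivity), zero_add]
    rw [legendrePoly, Polynomial.degree_mul, Polynomial.degree_C (by positivity), zero_add,
      Polynomial.degree_sub_eq_left_of_degree_lt, hlead]
    rw [hlead, hlow]
    exact_mod_cast (by omega : k < k + 2)

theorem legendre_one (k : ℕ) : legendre k 1 = 1 := by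
  induction k using Nat.twoStepInduction with
  | zero => simp [legendre]
  | one => simp [legendre]
  | more k h₀ h₁ =>
    have : (k : ℝ) + 2 ≠ 0 := by positivity
    rw [legendre, h₀, h₁]
    field_simp
    ring

theorem legendre_neg_one (k : ℕ) : legendre k (-1) = (-1) ^ k := by
  induction k using Nat.twoStepInduction with
  | zero => simp [legendre]
  | one => simp [legendre]
  | more k h₀ h₁ =>
    have : (k : ℝ) + 2 ≠ 0 := by positivity
    rw [legendre, h₀, h₁]
    field_simp
    ring

theorem integral_derivative_legendrePoly (k : ℕ) :
    ∫ s in (-1:ℝ)..1, (Polynomial.derivative (legendrePoly k)).eval s = 1 - (-1) ^ k := by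
  rw [intervalIntegral.integral_eq_sub_of_hasDerivAt
    (fun s _ => (legendrePoly k).hasDerivAt s)
    ((Polynomial.continuous _).intervalIntegrable _ _), eval_legendrePoly, eval_legendrePoly,
    legendre_one, legendre_neg_one]

/-- The Legendre polynomials form a polynomial sequence. -/
noncomputable def legendreSequence : Polynomial.Sequence ℝ where
  elems' := legendrePoly
  degree_eq' := degree_legendrePoly

/-- The derivatives of the nonconstant Legendre polynomials form a polynomial sequence. -/
noncomputable def derivativeLegendreSequence : Polynomial.Sequence ℝ where
  elems' k := Polynomial.derivative (legendrePoly (k + 1))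
  degree_eq' k := by
    have h : (legendrePoly (k + 1)).natDegree = k + 1 :=
      Polynomial.natDegree_eq_of_degree_eq_some (degree_legendrePoly _)
    rw [Polynomial.degree_derivative (by omega), h, Nat.add_sub_cancel]

theorem integral_mul_eq_zero_of_forall_derivative_legendrePoly {g : ℝ → ℝ} (hg : Continuous g)
    {p : ℕ} (h : ∀ k < p,
      ∫ s in (-1:ℝ)..1, g s * (Polynomial.derivative (legendrePoly (k + 1))).eval s = 0)
    {q : Polynomial ℝ} (hq : q ∈ Polynomial.degreeLT ℝ p) :
    ∫ s in (-1:ℝ)..1, g s * q.eval s = 0 := by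
  have hint (r : Polynomial ℝ) :
      IntervalIntegrable (fun s => g s * r.eval s) MeasureTheory.volume (-1) 1 :=
    (hg.mul r.continuous).intervalIntegrable _ _
  rw [← derivativeLegendreSequence.span_degreeLT fun i _ => by simp] at hq
  induction hq using Submodule.span_induction with
  | mem r hr =>
    obtain ⟨k, hk, rfl⟩ := hr
    exact h k hk
  | zero => simp
  | add r t _ _ hr ht =>
    simp only [Polynomial.eval_add, mul_add]
    rw [intervalIntegral.integral_add (hint r) (hint t), hr, ht, add_zero]
  | smul c r _ hr =>
    simp only [Polynomial.eval_smul, smul_eq_mul, mul_left_comm _ c]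
    rw [intervalIntegral.integral_const_mul, hr, mul_zero]

/-- If `f` is strictly decreasing on the values of a polynomial `w` of degree at most `p`, the
downwind boundary condition holds at `-1`, and `f ∘ w - f c` is orthogonal to the polynomials of
degree less than `p`, then `w` is constant: write `w - c = (1 + s) q` and test with `q`. -/
theorem Polynomial.eq_C_of_orthogonal {f : ℝ → ℝ} (hf : Continuous f) {S : Set ℝ}
    (hS : StrictAntiOn f S) {c : ℝ} (hc : c ∈ S) {p : ℕ} {w : Polynomial ℝ}
    (hdeg : w.degree < (p + 1 : ℕ)) (hw : ∀ s ∈ Set.Icc (-1:ℝ) 1, w.eval s ∈ S)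
    (hbdry : f (w.eval (-1)) = f c)
    (horth : ∀ q ∈ Polynomial.degreeLT ℝ p,
      ∫ s in (-1:ℝ)..1, (f (w.eval s) - f c) * q.eval s = 0) :
    w = Polynomial.C c := by
  have hroot : w.eval (-1) = c := hS.injOn (hw _ (by simp)) hc hbdry
  obtain ⟨q, hq⟩ : Polynomial.X - Polynomial.C (-1) ∣ w - Polynomial.C c :=
    Polynomial.dvd_iff_isRoot.2 (by simp [Polynomial.IsRoot, hroot])
  by_cases hq0 : q = 0
  · rwa [hq0, mul_zero, sub_eq_zero] at hq
  exfalso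
  have heval (s : ℝ) : w.eval s - c = (s + 1) * q.eval s := by
    simpa using congrArg (Polynomial.eval s) hq
  have hqmem : q ∈ Polynomial.degreeLT ℝ p := by
    rw [Polynomial.mem_degreeLT, ← Polynomial.natDegree_lt_iff_degree_lt hq0]
    have h1 : (w - Polynomial.C c).natDegree ≤ p := by
      rw [Polynomial.natDegree_sub_C]
      exact Polynomial.natDegree_le_of_degree_le (Order.lt_succ_iff.1 (by exact_mod_cast hdeg))
    rw [hq, Polynomial.natDegree_mul (Polynomial.X_sub_C_ne_zero _) hq0,
      Polynomial.natDegree_X_sub_C] at h1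
    omega
  have hneg (s : ℝ) (hs : s ∈ Set.Ioc (-1:ℝ) 1) (hqs : q.eval s ≠ 0) :
      (f (w.eval s) - f c) * q.eval s < 0 := by
    have hws := hw s ⟨hs.1.le, hs.2⟩
    have hs1 : 0 < s + 1 := by linarith [hs.1]
    rcases hqs.lt_or_gt with h | h
    · have : w.eval s < c := by linarith [heval s, mul_neg_of_pos_of_neg hs1 h]
      exact mul_neg_of_pos_of_neg (sub_pos.2 (hS hws hc this)) h
    · have : c < w.eval s := by linarith [heval s, mul_pos hs1 h]
      exact mul_neg_of_neg_of_pos (sub_neg.2 (hS hc hws this)) h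
  obtain ⟨s, hs, hqs⟩ : ∃ s ∈ Set.Ioc (-1:ℝ) 1, q.eval s ≠ 0 := by
    by_contra! h
    exact hq0 (Polynomial.eq_zero_of_infinite_isRoot q
      ((Set.Ioc_infinite (by norm_num)).mono fun s hs => h s hs))
  have hpos : 0 < ∫ s in (-1:ℝ)..1, -((f (w.eval s) - f c) * q.eval s) := by
    refine intervalIntegral.integral_pos (by norm_num) ?_ (fun s hs => ?_)
      ⟨s, Set.Ioc_subset_Icc_self hs, neg_pos.2 (hneg s hs hqs)⟩
    · exact (((hf.comp w.continuous).sub continuous_const).mul q.continuous).neg.continuousOn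
    · by_cases h : q.eval s = 0
      · simp [h]
      · exact (neg_pos.2 (hneg s hs h)).le
  rw [intervalIntegral.integral_neg, horth q hqmem] at hpos
  simp at hpos

/-- A function with continuous derivative is strictly decreasing near a point of negative
derivative. -/
theorem ContDiff.exists_ball_strictAntiOn {f : ℝ → ℝ} (hf : ContDiff ℝ 1 f) {c : ℝ}
    (hc : deriv f c < 0) : ∃ δ > 0, StrictAntiOn f (Metric.ball c δ) := by
  have hev : ∀ᶠ x in nhds c, deriv f x < 0 :=
    (hf.continuous_deriv le_rfl).continuousAt.eventually_lt continuousAt_const hc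
  obtain ⟨δ, hδ, h⟩ := Metric.eventually_nhds_iff_ball.1 hev
  exact ⟨δ, hδ, strictAntiOn_of_deriv_neg (convex_ball c δ) hf.continuous.continuousOn
    fun x hx => h x (interior_subset hx)⟩

/-- The polynomial with Legendre coefficients `U`. -/
noncomputable def legendreSum {n : ℕ} (U : Fin n → ℝ) : Polynomial ℝ :=
  ∑ l, U l • legendrePoly l

theorem eval_legendreSum {n : ℕ} (U : Fin n → ℝ) (s : ℝ) :
    (legendreSum U).eval s = ∑ l, U l * legendre l s := by
  simp [legendreSum, Polynomial.eval_finsetSum, eval_legendrePoly]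

theorem degree_legendreSum_lt {n : ℕ} (U : Fin n → ℝ) : (legendreSum U).degree < n := by
  rw [← Polynomial.mem_degreeLT]
  refine Submodule.sum_mem _ fun l _ => Submodule.smul_mem _ _ ?_
  rw [Polynomial.mem_degreeLT, degree_legendrePoly]
  exact_mod_cast l.isLt

theorem legendreSum_injective (n : ℕ) :
    Function.Injective (legendreSum : (Fin n → ℝ) → Polynomial ℝ) :=
  linearIndependent_iff_injective_fintypeLinearCombination.1
    (legendreSequence.linearIndependent.comp _ Fin.val_injective)

theorem legendreSum_const (n : ℕ) (c : ℝ) :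
    legendreSum (fun i : Fin (n + 1) => if i = 0 then c else 0) = Polynomial.C c := by
  simp [legendreSum, legendrePoly, Polynomial.smul_eq_C_mul]

/-- Local uniqueness of the uniform subsonic discrete solution: if `f` is `C²`
with `f'(u_R) < 0` and `f_∞ = f(u_R)`, then the point `U_R = (u_R, 0, …, 0)` is the
unique zero, in a sufficiently small open neighborhood, of the stationary DG
residual map `G` with downwind flux:
`G^0(U) = f(∑_l (-1)^l U_l) - f_∞` and, for `1 ≤ k ≤ p`,
`G^k(U) = ∫_{-1}^1 f(∑_l U_l L_l(s)) L_k'(s) ds - (1 - (-1)^k) f_∞`. -/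
theorem stmt6 (f : ℝ → ℝ) (hf : ContDiff ℝ 2 f) (uR : ℝ) (hR : deriv f uR < 0) (p : ℕ) :
    ∃ V : Set (Fin (p+1) → ℝ), IsOpen V ∧ (fun i => if i = 0 then uR else 0) ∈ V ∧
      ∀ U ∈ V,
        ((∀ k : Fin (p+1),
            (if (k : ℕ) = 0 then f (∑ l : Fin (p+1), (-1:ℝ)^(l : ℕ) * U l) - f uR
             else (∫ s in (-1:ℝ)..1,
                    f (∑ l, U l * legendre (l : ℕ) s) * deriv (legendre (k : ℕ)) s)
                  - (1 - (-1:ℝ)^(k : ℕ)) * f uR) = 0)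
          ↔ U = fun i => if i = 0 then uR else 0) := by
  obtain ⟨δ, hδ, hanti⟩ := (hf.of_le one_le_two).exists_ball_strictAntiOn hR
  have hcont : Continuous fun z : (Fin (p+1) → ℝ) × ℝ => (legendreSum z.1).eval z.2 := by
    simp only [legendreSum, Polynomial.eval_finsetSum, Polynomial.eval_smul, smul_eq_mul]
    fun_prop
  have hnhds : ∀ᶠ U in nhds (fun i : Fin (p+1) => if i = 0 then uR else 0),
      ∀ s ∈ Set.Icc (-1:ℝ) 1, (legendreSum U).eval s ∈ Metric.ball uR δ := by
    refine isCompact_Icc.eventually_forall_of_forall_eventually fun s _ => ?_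
    refine hcont.continuousAt.eventually_mem (Metric.isOpen_ball.mem_nhds ?_)
    simpa [legendreSum_const] using hδ
  obtain ⟨V, hV, hVo, hmem⟩ := eventually_nhds_iff.1 hnhds
  refine ⟨V, hVo, hmem, fun U hU => ?_⟩
  have hbdry : ∑ l : Fin (p+1), (-1:ℝ)^(l : ℕ) * U l = (legendreSum U).eval (-1) := by
    simp only [eval_legendreSum, legendre_neg_one, mul_comm]
  simp only [hbdry, ← eval_legendreSum, deriv_legendre]
  constructor
  · intro hG
    apply legendreSum_injective
    rw [legendreSum_const]
    have hg : Continuous fun s => f ((legendreSum U).eval s) - f uR :=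
      (hf.continuous.comp (legendreSum U).continuous).sub continuous_const
    refine Polynomial.eq_C_of_orthogonal hf.continuous hanti (Metric.mem_ball_self hδ)
      (degree_legendreSum_lt U) (hV U hU) ?_ fun q hq =>
        integral_mul_eq_zero_of_forall_derivative_legendrePoly hg (fun k hk => ?_) hq
    · simpa [sub_eq_zero] using hG 0
    · have h := hG ⟨k + 1, by omega⟩
      rw [if_neg k.succ_ne_zero] at h
      simp only [sub_mul]
      rw [intervalIntegral.integral_sub, intervalIntegral.integral_const_mul,
        integral_derivative_legendrePoly, mul_comm (f uR)]
      · exact h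
      · exact ((hf.continuous.comp (legendreSum U).continuous).mul
          (Polynomial.continuous _)).intervalIntegrable _ _
      · exact (continuous_const.mul (Polynomial.continuous _)).intervalIntegrable _ _
  · rintro rfl k
    simp only [legendreSum_const, Polynomial.eval_C, intervalIntegral.integral_const_mul,
      integral_derivative_legendrePoly]
    split_ifs <;> ring
end

section
/- Let s_c ∈ (−2/3, 2/3), u_L > 0 and λ > 0 be real numbers, and set u_h(s) = u_L (s_c + u_1 L_1(s) + u_2 L_2(s)) with u_1 = −√(3(1 − (9/4) s_c²)) and u_2 = −(5/2) s_c. Then the 3×3 matrix with entries T_{k,l} = δ_{k,l} + λ (2k+1) ∫_{-1}^{1} u_h(s) L_l(s) L_k'(s) ds for 0 ≤ k, l ≤ 2 has eigenvalues 1, 1 − λ u_L √(3(4 − 9 s_c²)), and 1 − 2 λ u_L √(3(4 − 9 s_c²)). -/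
theorem legendre_zero : legendre 0 = fun _ => 1 := by
  funext s; simp [legendre]

theorem legendre_one_s17 : legendre 1 = fun s => s := by
  funext s; simp [legendre]

theorem legendre_two : legendre 2 = fun s => (3 * s ^ 2 - 1) / 2 := by
  funext s; simp [legendre]; ring

theorem deriv_legendre_two (s : ℝ) : deriv (legendre 2) s = 3 * s := by
  rw [legendre_two]
  have h : HasDerivAt (fun s : ℝ => (3 * s ^ 2 - 1) / 2) ((3 * (2 * s)) / 2) s := by
    simpa using (((hasDerivAt_pow 2 s).const_mul 3).sub_const 1).div_const 2
  rw [h.deriv]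
  ring

theorem integral_quintic (a b c d e f : ℝ) :
    ∫ s in (-1 : ℝ)..1, (a + b * s + c * s ^ 2 + d * s ^ 3 + e * s ^ 4 + f * s ^ 5) =
      2 * a + 2 / 3 * c + 2 / 5 * e := by
  have h : ∀ s ∈ Set.uIcc (-1 : ℝ) 1,
      HasDerivAt (fun s : ℝ => a * s + b * (s ^ 2 / 2) + c * (s ^ 3 / 3) + d * (s ^ 4 / 4) +
        e * (s ^ 5 / 5) + f * (s ^ 6 / 6))
        (a + b * s + c * s ^ 2 + d * s ^ 3 + e * s ^ 4 + f * s ^ 5) s := by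
    intro s _
    have hp := ((((((hasDerivAt_id s).const_mul a).add
      (((hasDerivAt_pow 2 s).div_const 2).const_mul b)).add
      (((hasDerivAt_pow 3 s).div_const 3).const_mul c)).add
      (((hasDerivAt_pow 4 s).div_const 4).const_mul d)).add
      (((hasDerivAt_pow 5 s).div_const 5).const_mul e)).add
      (((hasDerivAt_pow 6 s).div_const 6).const_mul f)
    refine hp.congr_deriv ?_
    norm_num
  rw [intervalIntegral.integral_eq_sub_of_hasDerivAt h
    (Continuous.intervalIntegrable (by fun_prop) _ _)]
  ring

theorem spectrum_fin_three_of_zero_entries (x y z a b c : ℝ) :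
    spectrum ℝ !![x, 0, 0; a, y, b; c, 0, z] = {x, y, z} := by
  ext μ
  rw [spectrum.mem_iff, Matrix.isUnit_iff_isUnit_det, isUnit_iff_ne_zero, not_not]
  have h : (algebraMap ℝ (Matrix (Fin 3) (Fin 3) ℝ) μ - !![x, 0, 0; a, y, b; c, 0, z]).det =
      (μ - x) * ((μ - y) * (μ - z)) := by
    simp [Matrix.det_fin_three, Matrix.algebraMap_matrix_apply]
    ring
  rw [h]
  simp [sub_eq_zero]

/-- The `p = 2` shock-cell diagonal block of the linearized forward-Euler DG
scheme with Godunov flux around the `p = 2` discrete shock profile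
`u_h = u_L (s_c + u_1 L_1 + u_2 L_2)`, `u_1 = -√(3(1-(9/4)s_c²))`,
`u_2 = -(5/2)s_c`, of the Burgers equation: the matrix
`T_{k,l} = δ_{k,l} + λ (2k+1) ∫_{-1}^1 u_h L_l L_k'` has eigenvalues `1`,
`1 - λ u_L √(3(4-9s_c²))` and `1 - 2 λ u_L √(3(4-9s_c²))`. -/
theorem stmt17 (sc uL lam : ℝ) (hsc : sc ∈ Set.Ioo (-(2 : ℝ) / 3) (2 / 3))
    (huL : 0 < uL) (hlam : 0 < lam) (u1 u2 : ℝ)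
    (hu1 : u1 = -Real.sqrt (3 * (1 - (9 / 4) * sc ^ 2))) (hu2 : u2 = -(5 / 2) * sc)
    (uh : ℝ → ℝ)
    (huh : ∀ s, uh s = uL * (sc + u1 * legendre 1 s + u2 * legendre 2 s))
    (T : Matrix (Fin 3) (Fin 3) ℝ)
    (hT : T = Matrix.of fun k l : Fin 3 =>
      (if k = l then (1 : ℝ) else 0) +
        lam * (2 * (k : ℕ) + 1) *
          ∫ s in (-1:ℝ)..1, uh s * legendre (l : ℕ) s * deriv (legendre (k : ℕ)) s) :
    spectrum ℝ T =
      {1, 1 - lam * uL * Real.sqrt (3 * (4 - 9 * sc ^ 2)),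
       1 - 2 * lam * uL * Real.sqrt (3 * (4 - 9 * sc ^ 2))} := by
  have hw : Real.sqrt (3 * (4 - 9 * sc ^ 2)) = -(2 * u1) := by
    rw [hu1, show 3 * (4 - 9 * sc ^ 2) = 2 ^ 2 * (3 * (1 - (9 / 4) * sc ^ 2)) by ring,
      Real.sqrt_mul (by norm_num), Real.sqrt_sq (by norm_num)]
    ring
  have hu : uh = fun s => uL * (9 / 4 * sc + u1 * s - 15 / 4 * sc * s ^ 2) := by
    funext s
    rw [huh, legendre_one_s17, legendre_two, hu2]
    ring
  have h11 : ∫ s in (-1 : ℝ)..1, uh s * legendre 1 s * deriv (legendre 1) s =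
      uL * (2 / 3 * u1) := by
    simp only [hu, legendre_one_s17, deriv_id'']
    convert integral_quintic 0 (uL * (9 / 4 * sc)) (uL * u1) (-(uL * (15 / 4 * sc))) 0 0
      using 1
    · congr 1; funext s; ring
    · ring
  have h21 : ∫ s in (-1 : ℝ)..1, uh s * legendre 1 s * deriv (legendre 2) s = 0 := by
    simp only [hu, legendre_one_s17, deriv_legendre_two]
    convert integral_quintic 0 0 (uL * (27 / 4 * sc)) (3 * (uL * u1))
      (-(uL * (45 / 4 * sc))) 0 using 1
    · congr 1; funext s; ring
    · ring
  have h22 : ∫ s in (-1 : ℝ)..1, uh s * legendre 2 s * deriv (legendre 2) s =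
      uL * (4 / 5 * u1) := by
    simp only [hu, deriv_legendre_two]
    simp only [legendre_two]
    convert integral_quintic 0 (-(uL * (27 / 8 * sc))) (-(3 / 2 * (uL * u1)))
      (uL * (63 / 4 * sc)) (9 / 2 * (uL * u1)) (-(uL * (135 / 8 * sc))) using 1
    · congr 1; funext s; ring
    · ring
  have hT' : T = !![1, 0, 0;
      T 1 0, 1 - lam * uL * Real.sqrt (3 * (4 - 9 * sc ^ 2)), T 1 2;
      T 2 0, 0, 1 - 2 * lam * uL * Real.sqrt (3 * (4 - 9 * sc ^ 2))] := by
    ext k l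
    rw [hw]
    fin_cases k <;> fin_cases l <;> simp [hT, legendre_zero, h11, h21, h22] <;> ring
  rw [hT', spectrum_fin_three_of_zero_entries]
end
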